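/- If pattern q is a contiguous sub-pattern of pattern p (i.e., q = p_a p_{a+1} ... p_b for some 1 ≤ a ≤ b ≤ m where p = p_1 ... p_m), then the maximum number of pairwise nonoverlapping occurrences of q in any sequence s is at least the maximum number of pairwise nonoverlapping occurrences of p in s. -/

import Mathlib

/-- `IsOcc s p l` : `l` is an occurrence of pattern `p` in sequence `s`:
a strictly increasing list of indices into `s`, of the same length as `p`,
with coordinatewise containment of the pattern itemsets. -/
def IsOcc (s p : List (Finset ℕ)) (l : List ℕ) : Prop :=
  l.length = p.length ∧ l.Chain' (· < ·) ∧ (∀ x ∈ l, x < s.length) ∧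
  ∀ k, k < p.length → p.getD k ∅ ⊆ s.getD (l.getD k 0) ∅

/-- Two occurrences are nonoverlapping iff they differ at every coordinate. -/
def NonOverlap (l l' : List ℕ) : Prop :=
  ∀ k, k < l.length → l.getD k 0 ≠ l'.getD k 0

/-- `supp s p` : the maximum cardinality of a family of pairwise
nonoverlapping occurrences of `p` in `s`. -/
noncomputable def supp (s p : List (Finset ℕ)) : ℕ :=
  sSup {k | ∃ F : Finset (List ℕ), F.card = k ∧ (∀ l ∈ F, IsOcc s p l) ∧
    (F : Set (List ℕ)).Pairwise NonOverlap}

/-- Support of a pattern in a database: sum of supports over the sequences. -/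
noncomputable def suppD (D : List (List (Finset ℕ))) (p : List (Finset ℕ)) : ℕ :=
  (D.map (fun s => supp s p)).sum

theorem stmt0 (s p q : List (Finset ℕ)) (hq : q ≠ []) (hsub : q <:+: p) :
    supp s p ≤ supp s q := by
  have hq0 : 0 < q.length := List.length_pos_of_ne_nil hq
  obtain ⟨u, v, rfl⟩ := hsub
  unfold supp
  apply csSup_le_csSup
  · refine ⟨s.length, ?_⟩
    rintro k ⟨F, rfl, hF, hP⟩
    have := Finset.card_le_card_of_injOn (s := F) (t := Finset.range s.length)
      (fun l => l.getD 0 0) ?_ ?_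
    · simpa using this
    · intro l hl
      obtain ⟨h1, -, h3, -⟩ := hF l hl
      have h0 : 0 < l.length := by omega
      simp only [Finset.coe_range, Set.mem_Iio]
      rw [List.getD_eq_getElem _ _ h0]
      exact h3 _ (List.getElem_mem h0)
    · intro l hl l' hl' he
      by_contra hne
      have h1 := (hF l hl).1
      exact hP hl hl' hne 0 (by omega) he
  · exact ⟨0, ∅, by simp⟩
  · rintro k ⟨F, rfl, hF, hP⟩
    have key : ∀ l ∈ F, ∀ k, k < q.length →
        ((l.drop u.length).take q.length).getD k 0 = l.getD (u.length + k) 0 := by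
      intro l hl k hk
      simp [List.getD_eq_getElem?_getD, List.getElem?_take, hk]
    have hlen : ∀ l ∈ F, ((l.drop u.length).take q.length).length = q.length := by
      intro l hl
      have h1 := (hF l hl).1
      simp at h1 ⊢
      omega
    have hinj : Set.InjOn (fun l : List ℕ => (l.drop u.length).take q.length) F := by
      intro l hl l' hl' he
      by_contra hne
      have h1 := (hF l hl).1
      simp at h1
      apply hP hl hl' hne (u.length + 0) (by omega)
      rw [← key l hl 0 hq0, ← key l' hl' 0 hq0]
      exact congrArg (fun t => List.getD t 0 0) he
    refine ⟨F.image (fun l => (l.drop u.length).take q.length), 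
      Finset.card_image_of_injOn hinj, ?_, ?_⟩
    · intro m hm
      obtain ⟨l, hl, rfl⟩ := Finset.mem_image.1 hm
      obtain ⟨h1, h2, h3, h4⟩ := hF l hl
      refine ⟨hlen l hl, (List.IsChain.drop h2 _).take _, ?_, ?_⟩
      · intro x hx
        exact h3 x (List.mem_of_mem_drop (List.mem_of_mem_take hx))
      · intro k hk
        rw [key l hl k hk]
        have h5 := h4 (u.length + k) (by simp; omega)
        have h6 : (u ++ q ++ v).getD (u.length + k) ∅ = q.getD k ∅ := by
          simp [List.getD_eq_getElem?_getD, List.getElem?_append, hk]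
        rwa [h6] at h5
    · intro m hm m' hm' hne k hk
      obtain ⟨l, hl, rfl⟩ := Finset.mem_image.1 hm
      obtain ⟨l', hl', rfl⟩ := Finset.mem_image.1 hm'
      have hk' : k < q.length := by
        have := hlen l hl
        omega
      have hll : l ≠ l' := by
        rintro rfl
        exact hne rfl
      have h1 := (hF l hl).1
      simp at h1
      have := hP hl hl' hll (u.length + k) (by omega)
      rw [← key l hl k hk', ← key l' hl' k hk'] at this
      exact this
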